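/- arXiv:2309.16171 — 3 statements merged into one kernel-verified Lean document; each statement's English description precedes it below -/
import Mathlib

section
/- Let Q be a probability measure on a measurable space and let 𝒫 be a convex set of probability measures on the same space. Suppose P* ∈ 𝒫 attains the minimum of P ↦ KL(P||Q) over 𝒫 and that KL(P*||Q) < ∞. Then for every P ∈ 𝒫, KL(P*||Q) ≤ KL(P||Q) − KL(P||P*); equivalently, KL(P||P*) + KL(P*||Q) ≤ KL(P||Q). -/
open MeasureTheory
open scoped ENNReal

/-- Kullback–Leibler divergence `KL(P‖Q) = ∫ log (dP/dQ) dP` if `P ≪ Q` (and the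
log-likelihood ratio is integrable), and `+∞` otherwise. -/
noncomputable def klDiv {𝒳 : Type*} [MeasurableSpace 𝒳] (P Q : Measure 𝒳) : ℝ≥0∞ :=
  open Classical in
  if P ≪ Q ∧ Integrable (fun x => Real.log (P.rnDeriv Q x).toReal) P then
    ENNReal.ofReal (∫ x, Real.log (P.rnDeriv Q x).toReal ∂P)
  else ∞

/-- The density of the Kullback–Leibler divergence between two measures, as a function of their
densities `a` and `b` with respect to a common dominating measure. -/
noncomputable def klDensity (a b : ℝ) : ℝ≥0∞ :=
  if b = 0 ∧ a ≠ 0 then ∞ else ENNReal.ofReal (b * InformationTheory.klFun (a / b))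

section KLDensity

open Filter Topology InformationTheory

theorem klDiv_eq_informationTheory_klDiv {𝒳 : Type*} [MeasurableSpace 𝒳] (P Q : Measure 𝒳)
    [IsProbabilityMeasure P] [IsProbabilityMeasure Q] :
    _root_.klDiv P Q = InformationTheory.klDiv P Q := by
  rw [_root_.klDiv, InformationTheory.klDiv_def]
  simp only [llr_def, probReal_univ, add_sub_cancel_right]
  congr

theorem measurable_klDensity : Measurable fun z : ℝ × ℝ => klDensity z.1 z.2 := by
  unfold klDensity
  refine Measurable.ite ?_ measurable_const (by fun_prop)
  exact (measurable_snd (measurableSet_singleton 0)).inter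
    (measurable_fst (measurableSet_singleton 0).compl)

/-- Pointwise compensation inequality for a mixture of two densities. -/
theorem klDensity_mix_add_klFun_le {a b θ : ℝ} (ha : 0 ≤ a) (hb : 0 ≤ b)
    (h0 : 0 < θ) (h1 : θ < 1) :
    ENNReal.ofReal θ * klDensity a (θ * a + (1 - θ) * b)
        + ENNReal.ofReal (klFun (θ * a + (1 - θ) * b))
      ≤ ENNReal.ofReal θ * ENNReal.ofReal (klFun a)
        + ENNReal.ofReal (1 - θ) * ENNReal.ofReal (klFun b) := by
  have h1' : 0 < 1 - θ := by linarith
  set c := θ * a + (1 - θ) * b with hc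
  have hac : c = 0 → a = 0 ∧ b = 0 := fun h => by
    have h2 := mul_nonneg h0.le ha
    have h3 := mul_nonneg h1'.le hb
    have ha0 : θ * a = 0 := by linarith
    have hb0 : (1 - θ) * b = 0 := by linarith
    exact ⟨by simpa [h0.ne'] using ha0, by simpa [h1'.ne'] using hb0⟩
  have hc0 : 0 ≤ c := by positivity
  rw [klDensity, if_neg (fun h => h.2 (hac h.1).1),
    ← ENNReal.ofReal_mul h0.le, ← ENNReal.ofReal_mul h0.le, ← ENNReal.ofReal_mul h1'.le,
    ← ENNReal.ofReal_add (mul_nonneg h0.le (mul_nonneg hc0 (klFun_nonneg (by positivity))))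
      (klFun_nonneg hc0),
    ← ENNReal.ofReal_add (mul_nonneg h0.le (klFun_nonneg ha)) (mul_nonneg h1'.le (klFun_nonneg hb))]
  refine ENNReal.ofReal_le_ofReal ?_
  rcases hc0.eq_or_lt with hcz | hcp
  · obtain ⟨rfl, rfl⟩ := hac hcz.symm
    simp [← hcz, klFun_zero]
  have hg : ∀ t, 0 ≤ t → c * klFun (t / c) = t * Real.log t - t * Real.log c + c - t := by
    intro t ht
    rcases ht.eq_or_lt with rfl | ht
    · simp [klFun_zero]
    · rw [klFun_apply, Real.log_div ht.ne' hcp.ne']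
      field_simp
  have hnn : 0 ≤ (1 - θ) * (c * klFun (b / c)) :=
    mul_nonneg h1'.le (mul_nonneg hc0 (klFun_nonneg (by positivity)))
  rw [hg b hb] at hnn
  rw [hg a ha]
  simp only [klFun_apply]
  have hlog : c * Real.log c = θ * a * Real.log c + (1 - θ) * b * Real.log c := by
    rw [hc]; ring
  nlinarith

theorem tendsto_klDensity_mix {a b : ℝ} (ha : 0 ≤ a) (hb : 0 ≤ b) {θ : ℕ → ℝ}
    (hθ : ∀ n, 0 < θ n) (hlim : Tendsto θ atTop (𝓝 0)) :
    Tendsto (fun n => klDensity a (θ n * a + (1 - θ n) * b)) atTop (𝓝 (klDensity a b)) := by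
  rcases hb.eq_or_lt with rfl | hb
  · rcases ha.eq_or_lt with rfl | ha
    · simp
    have heq : ∀ n, klDensity a (θ n * a + (1 - θ n) * 0)
        = ENNReal.ofReal (a * (-Real.log (θ n) + θ n - 1)) := by
      intro n
      have := hθ n
      rw [klDensity, if_neg (by simp [this.ne', ha.ne'])]
      congr 1
      rw [mul_zero, add_zero, show a / (θ n * a) = (θ n)⁻¹ by field_simp, klFun_apply,
        Real.log_inv]
      field_simp
    simp only [heq]
    rw [klDensity, if_pos ⟨rfl, ha.ne'⟩]
    refine ENNReal.tendsto_ofReal_atTop.comp (Tendsto.const_mul_atTop ha ?_)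
    have hlog : Tendsto (fun n => -Real.log (θ n)) atTop atTop :=
      tendsto_neg_atBot_atTop.comp (Real.tendsto_log_nhdsGT_zero.comp
        (tendsto_nhdsWithin_iff.2 ⟨hlim, .of_forall hθ⟩))
    simpa [sub_eq_add_neg, add_assoc] using hlog.atTop_add (hlim.sub_const 1)
  · have hmix : Tendsto (fun n => θ n * a + (1 - θ n) * b) atTop (𝓝 b) := by
      simpa using (hlim.mul_const a).add ((hlim.const_sub 1).mul_const b)
    rw [klDensity, if_neg (by simp [hb.ne'])]
    refine (ENNReal.tendsto_ofReal (hmix.mul ((continuous_klFun.tendsto _).comp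
      (tendsto_const_nhds.div hmix hb.ne')))).congr' ?_
    filter_upwards [hmix.eventually_ne hb.ne'] with n hn
    simp [klDensity, hn]

/-- The divergence is bounded by the integral of `klDensity` against any dominating measure. -/
theorem klDiv_le_lintegral_klDensity {𝒳 : Type*} [MeasurableSpace 𝒳] {P R Q : Measure 𝒳}
    [IsFiniteMeasure P] [IsFiniteMeasure R] [IsFiniteMeasure Q] (hPQ : P ≪ Q) (hRQ : R ≪ Q) :
    InformationTheory.klDiv P R
      ≤ ∫⁻ x, klDensity (P.rnDeriv Q x).toReal (R.rnDeriv Q x).toReal ∂Q := by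
  have hmeas : Measurable fun x => klDensity (P.rnDeriv Q x).toReal (R.rnDeriv Q x).toReal :=
    measurable_klDensity.comp ((Measure.measurable_rnDeriv P Q).ennreal_toReal.prodMk
      (Measure.measurable_rnDeriv R Q).ennreal_toReal)
  by_cases hfin : ∫⁻ x, klDensity (P.rnDeriv Q x).toReal (R.rnDeriv Q x).toReal ∂Q = ∞
  · simp [hfin]
  have hPR : P ≪ R := by
    have hpos : ∀ᵐ x ∂P, R.rnDeriv Q x ≠ 0 := by
      filter_upwards [hPQ.ae_le (ae_lt_top hmeas hfin), Measure.rnDeriv_pos hPQ,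
        hPQ.ae_le (Measure.rnDeriv_lt_top P Q)] with x hx hp hp' h0
      simp [klDensity, h0, ENNReal.toReal_eq_zero_iff, hp.ne', hp'.ne] at hx
    refine Measure.AbsolutelyContinuous.mk fun A hA hRA => ?_
    rw [← Measure.withDensity_rnDeriv_eq R Q hRQ, withDensity_apply _ hA,
      lintegral_eq_zero_iff (Measure.measurable_rnDeriv R Q)] at hRA
    have hRA' := (hPQ.restrict A).ae_le hRA
    have : ∀ᵐ x ∂P.restrict A, False := by
      filter_upwards [hRA', ae_restrict_of_ae hpos] with x h1 h2 using h2 h1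
    simpa [ae_iff] using this
  rw [klDiv_eq_lintegral_klFun_of_ac hPR, ← lintegral_rnDeriv_mul hRQ (by fun_prop)]
  refine lintegral_mono_ae ?_
  filter_upwards [Measure.rnDeriv_mul_rnDeriv hPR (κ := Q), Measure.rnDeriv_lt_top R Q]
    with x hx hr
  rw [klDensity]
  split_ifs with h
  · exact le_top
  rw [← hx, ENNReal.ofReal_mul ENNReal.toReal_nonneg, ENNReal.ofReal_toReal hr.ne]
  by_cases h0 : R.rnDeriv Q x = 0
  · simp [h0]
  · have : (R.rnDeriv Q x).toReal ≠ 0 := by simp [ENNReal.toReal_eq_zero_iff, h0, hr.ne]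
    simp [ENNReal.toReal_mul, this]

/-- Integrated compensation inequality for a mixture of two measures. -/
theorem lintegral_klDensity_mix_add_klDiv_le {𝒳 : Type*} [MeasurableSpace 𝒳] {P R Q : Measure 𝒳}
    [IsFiniteMeasure P] [IsFiniteMeasure R] [IsFiniteMeasure Q] (hPQ : P ≪ Q) (hRQ : R ≪ Q)
    {θ : ℝ} (h0 : 0 < θ) (h1 : θ < 1) :
    ENNReal.ofReal θ * (∫⁻ x, klDensity (P.rnDeriv Q x).toReal
          (θ * (P.rnDeriv Q x).toReal + (1 - θ) * (R.rnDeriv Q x).toReal) ∂Q)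
        + InformationTheory.klDiv (ENNReal.ofReal θ • P + ENNReal.ofReal (1 - θ) • R) Q
      ≤ ENNReal.ofReal θ * InformationTheory.klDiv P Q
        + ENNReal.ofReal (1 - θ) * InformationTheory.klDiv R Q := by
  have : IsFiniteMeasure (ENNReal.ofReal θ • P) := P.smul_finite ENNReal.ofReal_ne_top
  have : IsFiniteMeasure (ENNReal.ofReal (1 - θ) • R) := R.smul_finite ENNReal.ofReal_ne_top
  have hmix : ENNReal.ofReal θ • P + ENNReal.ofReal (1 - θ) • R ≪ Q :=
    (hPQ.smul_left _).add_left (hRQ.smul_left _)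
  have hmeas : Measurable fun x => klDensity (P.rnDeriv Q x).toReal
      (θ * (P.rnDeriv Q x).toReal + (1 - θ) * (R.rnDeriv Q x).toReal) :=
    measurable_klDensity.comp
      (f := fun x => ((P.rnDeriv Q x).toReal,
        θ * (P.rnDeriv Q x).toReal + (1 - θ) * (R.rnDeriv Q x).toReal)) (by fun_prop)
  have hmeas' : ∀ μ : Measure 𝒳,
      Measurable fun x => ENNReal.ofReal (klFun (μ.rnDeriv Q x).toReal) := by fun_prop
  rw [klDiv_eq_lintegral_klFun_of_ac hmix, klDiv_eq_lintegral_klFun_of_ac hPQ,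
    klDiv_eq_lintegral_klFun_of_ac hRQ, ← lintegral_const_mul _ hmeas,
    ← lintegral_const_mul _ (hmeas' P), ← lintegral_const_mul _ (hmeas' R),
    ← lintegral_add_left (hmeas.const_mul _),
    ← lintegral_add_left ((hmeas' P).const_mul _)]
  refine lintegral_mono_ae ?_
  filter_upwards [Measure.rnDeriv_add (ENNReal.ofReal θ • P) (ENNReal.ofReal (1 - θ) • R) Q,
    Measure.rnDeriv_smul_left_of_ne_top P Q (r := ENNReal.ofReal θ) ENNReal.ofReal_ne_top,
    Measure.rnDeriv_smul_left_of_ne_top R Q (r := ENNReal.ofReal (1 - θ)) ENNReal.ofReal_ne_top,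
    Measure.rnDeriv_lt_top P Q, Measure.rnDeriv_lt_top R Q] with x hadd hP hR hp hr
  have hx : ((ENNReal.ofReal θ • P + ENNReal.ofReal (1 - θ) • R).rnDeriv Q x).toReal
      = θ * (P.rnDeriv Q x).toReal + (1 - θ) * (R.rnDeriv Q x).toReal := by
    rw [hadd, Pi.add_apply, hP, hR, Pi.smul_apply, Pi.smul_apply, smul_eq_mul, smul_eq_mul,
      ENNReal.toReal_add (ENNReal.mul_ne_top ENNReal.ofReal_ne_top hp.ne)
        (ENNReal.mul_ne_top ENNReal.ofReal_ne_top hr.ne), ENNReal.toReal_mul, ENNReal.toReal_mul,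
      ENNReal.toReal_ofReal h0.le, ENNReal.toReal_ofReal (by linarith)]
  rw [hx]
  exact klDensity_mix_add_klFun_le ENNReal.toReal_nonneg ENNReal.toReal_nonneg h0 h1

/-- Pythagorean inequality: if `R` has no larger divergence than its mixtures with `P`, then
`KL(P‖R) + KL(R‖Q) ≤ KL(P‖Q)`. -/
theorem klDiv_add_klDiv_le_of_le_mix {𝒳 : Type*} [MeasurableSpace 𝒳] {P R Q : Measure 𝒳}
    [IsFiniteMeasure P] [IsFiniteMeasure R] [IsFiniteMeasure Q] (hPQ : P ≪ Q)
    (hfin : InformationTheory.klDiv R Q ≠ ∞)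
    (hmin : ∀ θ : ℝ, 0 < θ → θ < 1 → InformationTheory.klDiv R Q
      ≤ InformationTheory.klDiv (ENNReal.ofReal θ • P + ENNReal.ofReal (1 - θ) • R) Q) :
    InformationTheory.klDiv P R + InformationTheory.klDiv R Q ≤ InformationTheory.klDiv P Q := by
  have hRQ : R ≪ Q := (klDiv_ne_top_iff.1 hfin).1
  have hbound : ∀ θ : ℝ, 0 < θ → θ < 1 →
      (∫⁻ x, klDensity (P.rnDeriv Q x).toReal
          (θ * (P.rnDeriv Q x).toReal + (1 - θ) * (R.rnDeriv Q x).toReal) ∂Q)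
        + InformationTheory.klDiv R Q ≤ InformationTheory.klDiv P Q := by
    intro θ h0 h1
    have hθ : ENNReal.ofReal θ ≠ 0 := by simpa using h0
    rw [← ENNReal.mul_le_mul_iff_right hθ ENNReal.ofReal_ne_top,
      ← ENNReal.add_le_add_iff_right (ENNReal.mul_ne_top
        (ENNReal.ofReal_ne_top (r := 1 - θ)) hfin), mul_add, add_assoc, ← add_mul,
      ← ENNReal.ofReal_add h0.le (by linarith)]
    simp only [add_sub_cancel, ENNReal.ofReal_one, one_mul]
    exact (add_le_add_right (hmin θ h0 h1) _).trans
      (lintegral_klDensity_mix_add_klDiv_le hPQ hRQ h0 h1)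
  have hle : InformationTheory.klDiv R Q ≤ InformationTheory.klDiv P Q :=
    le_add_self.trans (hbound 2⁻¹ (by norm_num) (by norm_num))
  set θ : ℕ → ℝ := fun n => 1 / ((n + 1 : ℕ) + 1)
  have hθ0 : ∀ n, 0 < θ n := fun n => by positivity
  have hθ1 : ∀ n, θ n < 1 := fun n => by
    rw [div_lt_one (by positivity)]
    push_cast
    linarith [n.cast_nonneg (α := ℝ)]
  have hlim : Tendsto θ atTop (𝓝 0) :=
    tendsto_one_div_add_atTop_nhds_zero_nat.comp (tendsto_add_atTop_nat 1)
  refine add_le_of_le_tsub_right_of_le hle ((klDiv_le_lintegral_klDensity hPQ hRQ).trans ?_)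
  calc ∫⁻ x, klDensity (P.rnDeriv Q x).toReal (R.rnDeriv Q x).toReal ∂Q
      = ∫⁻ x, liminf (fun n => klDensity (P.rnDeriv Q x).toReal
          (θ n * (P.rnDeriv Q x).toReal + (1 - θ n) * (R.rnDeriv Q x).toReal)) atTop ∂Q :=
        lintegral_congr fun x => (tendsto_klDensity_mix ENNReal.toReal_nonneg
          ENNReal.toReal_nonneg hθ0 hlim).liminf_eq.symm
    _ ≤ liminf (fun n => ∫⁻ x, klDensity (P.rnDeriv Q x).toReal
          (θ n * (P.rnDeriv Q x).toReal + (1 - θ n) * (R.rnDeriv Q x).toReal) ∂Q) atTop :=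
        lintegral_liminf_le fun n => measurable_klDensity.comp
          (f := fun x => ((P.rnDeriv Q x).toReal,
            θ n * (P.rnDeriv Q x).toReal + (1 - θ n) * (R.rnDeriv Q x).toReal)) (by fun_prop)
    _ ≤ InformationTheory.klDiv P Q - InformationTheory.klDiv R Q :=
        liminf_le_of_frequently_le' (Frequently.of_forall fun n =>
          ENNReal.le_sub_of_add_le_right hfin (hbound (θ n) (hθ0 n) (hθ1 n)))

end KLDensity

/-- If `P*` minimizes `KL(·‖Q)` over a convex set `𝒮` of probability
measures and `KL(P*‖Q) < ∞`, then for every `P ∈ 𝒮`,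
`KL(P‖P*) + KL(P*‖Q) ≤ KL(P‖Q)` (equivalently `KL(P*‖Q) ≤ KL(P‖Q) − KL(P‖P*)`). -/
theorem stmt1 {𝒳 : Type*} [MeasurableSpace 𝒳] (Q : Measure 𝒳) [IsProbabilityMeasure Q]
    (𝒮 : Set (Measure 𝒳)) (hprob : ∀ P ∈ 𝒮, IsProbabilityMeasure P)
    (hconv : ∀ P ∈ 𝒮, ∀ P' ∈ 𝒮, ∀ θ : ℝ, θ ∈ Set.Ioo (0 : ℝ) 1 →
      (ENNReal.ofReal θ • P + ENNReal.ofReal (1 - θ) • P') ∈ 𝒮)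
    (Pstar : Measure 𝒳) (hmem : Pstar ∈ 𝒮)
    (hmin : ∀ P ∈ 𝒮, klDiv Pstar Q ≤ klDiv P Q)
    (hfin : klDiv Pstar Q < ∞) :
    ∀ P ∈ 𝒮, klDiv P Pstar + klDiv Pstar Q ≤ klDiv P Q := by
  intro P hP
  have := hprob P hP
  have := hprob Pstar hmem
  rw [klDiv_eq_informationTheory_klDiv Pstar Q] at hfin
  rw [klDiv_eq_informationTheory_klDiv, klDiv_eq_informationTheory_klDiv,
    klDiv_eq_informationTheory_klDiv]
  by_cases hPQ : P ≪ Q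
  · refine klDiv_add_klDiv_le_of_le_mix hPQ hfin.ne fun θ h0 h1 => ?_
    have hmix := hconv P hP Pstar hmem θ ⟨h0, h1⟩
    have := hprob _ hmix
    simpa only [klDiv_eq_informationTheory_klDiv] using hmin _ hmix
  · simp [InformationTheory.klDiv_of_not_ac hPQ]
end

section
/- Let (𝒳, c) be a Polish metric space, s ≥ 1, μ a σ-finite Borel measure on 𝒳, and Q a probability measure with density q with respect to μ. Let ω_1, …, ω_n ∈ 𝒳, let P̂_n := (1/n) Σ_{i=1}^n δ_{ω_i}, and let r ≥ 0. For λ ≥ 0 and u ∈ ℝ^n define C_{λ,u}(x) := min_{1≤i≤n} (λ c(x,ω_i)^s − u_i) and η(λ,u) := ∫ q(x) e^{−C_{λ,u}(x)} dμ(x). Then (weak duality) for every Borel probability measure P with W_s(P, P̂_n) ≤ r and ∫ c(x,ω_1)^s dP(x) < ∞, and every (λ,u) with λ ≥ 0, u ∈ ℝ^n and 0 < η(λ,u) < ∞, one has KL(P||Q) ≥ −λ r^s + (1/n) Σ_{i=1}^n u_i − log η(λ,u). -/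
open MeasureTheory
open scoped ENNReal

/-- `C_{λ,u}(x) = min_{1 ≤ i ≤ n} (λ c(x,ω_i)^s - u_i)`. -/
noncomputable def Cfun {𝒳 : Type*} [PseudoMetricSpace 𝒳] {n : ℕ} (hn : 1 ≤ n) (s : ℝ)
    (ω : Fin n → 𝒳) (lam : ℝ) (u : Fin n → ℝ) (x : 𝒳) : ℝ :=
  Finset.univ.inf' ⟨⟨0, hn⟩, Finset.mem_univ _⟩ fun i => lam * dist x (ω i) ^ s - u i

/-- `η(λ,u) = ∫ q(x) e^{-C_{λ,u}(x)} dμ(x)` (as an extended nonnegative real). -/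
noncomputable def etaFun {𝒳 : Type*} [PseudoMetricSpace 𝒳] [MeasurableSpace 𝒳] {n : ℕ}
    (hn : 1 ≤ n) (s : ℝ) (ω : Fin n → 𝒳) (μ : Measure 𝒳) (q : 𝒳 → ℝ)
    (lam : ℝ) (u : Fin n → ℝ) : ℝ≥0∞ :=
  ∫⁻ x, ENNReal.ofReal (q x * Real.exp (-(Cfun hn s ω lam u x))) ∂μ

/-- The Wasserstein distance of order `s` (valued in `ℝ≥0∞`):
`W_s(P,P') = (inf_Γ ∫ c(x,y)^s dΓ)^{1/s}`, the infimum being over all couplings `Γ` of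
`P` and `P'`, i.e. probability measures on the product with marginals `P` and `P'`. -/
noncomputable def wassE {𝒳 : Type*} [MeasurableSpace 𝒳] [PseudoMetricSpace 𝒳] (s : ℝ)
    (P P' : Measure 𝒳) : ℝ≥0∞ :=
  (⨅ Γ ∈ {Γ : Measure (𝒳 × 𝒳) | IsProbabilityMeasure Γ ∧
      Γ.map Prod.fst = P ∧ Γ.map Prod.snd = P'},
    ∫⁻ p, ENNReal.ofReal (dist p.1 p.2 ^ s) ∂Γ) ^ (1 / s)

section WeakDuality

variable {𝒳 : Type*}

lemma Cfun_le [PseudoMetricSpace 𝒳] {n : ℕ} (hn : 1 ≤ n) (s : ℝ) (ω : Fin n → 𝒳) (lam : ℝ)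
    (u : Fin n → ℝ) (x : 𝒳) (i : Fin n) :
    Cfun hn s ω lam u x ≤ lam * dist x (ω i) ^ s - u i :=
  Finset.inf'_le _ (Finset.mem_univ i)

lemma neg_sum_abs_le_Cfun [PseudoMetricSpace 𝒳] {n : ℕ} (hn : 1 ≤ n) (s : ℝ) (ω : Fin n → 𝒳)
    {lam : ℝ} (hlam : 0 ≤ lam) (u : Fin n → ℝ) (x : 𝒳) :
    -∑ i, |u i| ≤ Cfun hn s ω lam u x := by
  refine Finset.le_inf' _ _ fun i _ => ?_
  have h1 : |u i| ≤ ∑ j, |u j| :=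
    Finset.single_le_sum (f := fun j => |u j|) (fun j _ => abs_nonneg _) (Finset.mem_univ i)
  have h2 : 0 ≤ lam * dist x (ω i) ^ s := by positivity
  linarith [le_abs_self (u i)]

lemma measurable_Cfun [PseudoMetricSpace 𝒳] [MeasurableSpace 𝒳] [OpensMeasurableSpace 𝒳] {n : ℕ}
    (hn : 1 ≤ n) (s : ℝ) (ω : Fin n → 𝒳) (lam : ℝ) (u : Fin n → ℝ) :
    Measurable (Cfun hn s ω lam u) := by
  have hne : (Finset.univ : Finset (Fin n)).Nonempty := ⟨⟨0, hn⟩, Finset.mem_univ _⟩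
  have h : Measurable (Finset.univ.inf' hne fun i x => lam * dist x (ω i) ^ s - u i) :=
    Finset.inf'_induction _ _ (fun _ hf _ hg => hf.inf hg) fun i _ =>
      (((continuous_id.dist continuous_const).measurable.pow_const s).const_mul lam).sub_const (u i)
  convert h using 1
  ext x
  exact (Finset.inf'_apply hne (fun i x => lam * dist x (ω i) ^ s - u i) x).symm

lemma integrable_of_lintegral_ofReal_lt_top {α : Type*} [MeasurableSpace α] {ν : Measure α}
    {f : α → ℝ} (hf : AEStronglyMeasurable f ν) (hf0 : 0 ≤ f)
    (h : ∫⁻ x, ENNReal.ofReal (f x) ∂ν < ∞) : Integrable f ν :=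
  ⟨hf, (hasFiniteIntegral_iff_ofReal (Filter.Eventually.of_forall hf0)).2 h⟩

lemma integrable_Cfun [PseudoMetricSpace 𝒳] [MeasurableSpace 𝒳] [OpensMeasurableSpace 𝒳] {n : ℕ}
    (hn : 1 ≤ n) (s : ℝ) (ω : Fin n → 𝒳) {lam : ℝ} (hlam : 0 ≤ lam) (u : Fin n → ℝ)
    {P : Measure 𝒳} [IsFiniteMeasure P]
    (hmom : ∫⁻ x, ENNReal.ofReal (dist x (ω ⟨0, hn⟩) ^ s) ∂P < ∞) :
    Integrable (Cfun hn s ω lam u) P := by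
  have hd : Integrable (fun x => dist x (ω ⟨0, hn⟩) ^ s) P :=
    integrable_of_lintegral_ofReal_lt_top
      ((continuous_id.dist continuous_const).measurable.pow_const s).aestronglyMeasurable
      (fun x => by positivity) hmom
  exact integrable_of_le_of_le (measurable_Cfun hn s ω lam u).aestronglyMeasurable
    (Filter.Eventually.of_forall (neg_sum_abs_le_Cfun hn s ω hlam u))
    (Filter.Eventually.of_forall fun x => Cfun_le hn s ω lam u x ⟨0, hn⟩)
    (integrable_const _) ((hd.const_mul lam).sub (integrable_const _))

/-- The Donsker–Varadhan lower bound on relative entropy. -/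
lemma integral_sub_log_integral_exp_le_integral_llr [MeasurableSpace 𝒳] {P Q : Measure 𝒳}
    [IsProbabilityMeasure P] [IsProbabilityMeasure Q] (hPQ : P ≪ Q)
    (hllr : Integrable (llr P Q) P) {f : 𝒳 → ℝ} (hf : Integrable f P)
    (hexp : Integrable (fun x => Real.exp (f x)) Q) :
    ∫ x, f x ∂P - Real.log (∫ x, Real.exp (f x) ∂Q) ≤ ∫ x, llr P Q x ∂P := by
  have := isProbabilityMeasure_tilted hexp
  have h := InformationTheory.integral_llr_add_sub_measure_univ_nonneg
    (hPQ.trans (absolutelyContinuous_tilted hexp)) (integrable_llr_tilted_right hPQ hf hllr hexp)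
  rw [integral_llr_tilted_right hPQ hf hexp hllr] at h
  simp only [probReal_univ] at h
  linarith

/-- A coupling of `P` with the empirical measure of `ω` bounds the `P`-integral of `Cfun`. -/
lemma integral_Cfun_le_of_coupling [MetricSpace 𝒳] [SecondCountableTopology 𝒳]
    [MeasurableSpace 𝒳] [BorelSpace 𝒳] {n : ℕ} (hn : 1 ≤ n) (s : ℝ) (ω : Fin n → 𝒳) {lam : ℝ}
    (u : Fin n → ℝ) {P : Measure 𝒳}
    (hC : Integrable (Cfun hn s ω lam u) P) {Γ : Measure (𝒳 × 𝒳)} [IsProbabilityMeasure Γ]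
    (hfst : Γ.map Prod.fst = P)
    (hsnd : Γ.map Prod.snd = (n : ℝ≥0∞)⁻¹ • ∑ i, Measure.dirac (ω i))
    (hd : Integrable (fun p : 𝒳 × 𝒳 => dist p.1 p.2 ^ s) Γ) :
    ∫ x, Cfun hn s ω lam u x ∂P ≤
      lam * ∫ p, dist p.1 p.2 ^ s ∂Γ - (1 / n : ℝ) * ∑ i, u i := by
  classical
  have hne : (Finset.univ : Finset (Fin n)).Nonempty := ⟨⟨0, hn⟩, Finset.mem_univ _⟩
  set K : ℝ := ∑ i, |u i|
  have hKu (i : Fin n) : |u i| ≤ K :=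
    Finset.single_le_sum (f := fun j => |u j|) (fun j _ => abs_nonneg _) (Finset.mem_univ i)
  -- A measurable potential on the second coordinate dominating `u i` at each atom `ω i`.
  set v : 𝒳 → ℝ := Finset.univ.sup' hne fun i y => if y = ω i then u i else -K with hv
  have hvm : Measurable v := Finset.sup'_induction _ _ (fun _ hf _ hg => hf.sup hg) fun i _ =>
    Measurable.ite (measurableSet_singleton (ω i)) measurable_const measurable_const
  have hvapp (y : 𝒳) : v y = Finset.univ.sup' hne fun i => if y = ω i then u i else -K := by
    rw [hv, Finset.sup'_apply]
  have hvω (i : Fin n) : u i ≤ v (ω i) := by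
    rw [hvapp]
    exact (Finset.le_sup' (fun j => if ω i = ω j then u j else -K) (Finset.mem_univ i)).trans'
      (by simp)
  have hvb (y : 𝒳) : ‖v y‖ ≤ K := by
    rw [Real.norm_eq_abs, abs_le, hvapp]
    constructor
    · refine (Finset.le_sup' _ (Finset.mem_univ ⟨0, hn⟩)).trans' ?_
      split_ifs
      · linarith [neg_abs_le (u ⟨0, hn⟩), hKu ⟨0, hn⟩]
      · exact le_rfl
    · refine Finset.sup'_le _ _ fun i _ => ?_
      split_ifs
      · exact (le_abs_self _).trans (hKu i)
      · linarith [abs_nonneg (u i), hKu i]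
  have hle (x : 𝒳) (j : Fin n) : Cfun hn s ω lam u x ≤ lam * dist x (ω j) ^ s - v (ω j) := by
    have : v (ω j) ≤ lam * dist x (ω j) ^ s - Cfun hn s ω lam u x := by
      rw [hvapp]
      refine Finset.sup'_le _ _ fun i _ => ?_
      split_ifs with hij
      · rw [hij]
        linarith [Cfun_le hn s ω lam u x i]
      · linarith [Cfun_le hn s ω lam u x j, neg_abs_le (u j), hKu j]
    linarith
  have hae : ∀ᵐ p ∂Γ, p.2 ∈ Set.range ω := by
    have : ∀ᵐ y ∂Γ.map Prod.snd, y ∈ Set.range ω := by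
      rw [hsnd]
      refine Measure.ae_smul_measure ?_ _
      rw [ae_iff, Measure.finsetSum_apply]
      refine Finset.sum_eq_zero fun i _ => ?_
      simp [Measure.dirac_apply]
    exact ae_of_ae_map measurable_snd.aemeasurable this
  have hvΓ : Integrable (fun p : 𝒳 × 𝒳 => v p.2) Γ :=
    Integrable.of_bound (hvm.comp measurable_snd).aestronglyMeasurable K
      (Filter.Eventually.of_forall fun p => hvb p.2)
  have hCΓ : Integrable (fun p : 𝒳 × 𝒳 => Cfun hn s ω lam u p.1) Γ := by
    rw [← hfst] at hC
    exact hC.comp_measurable measurable_fst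
  have hCeq : ∫ x, Cfun hn s ω lam u x ∂P = ∫ p, Cfun hn s ω lam u p.1 ∂Γ := by
    rw [← hfst, integral_map measurable_fst.aemeasurable
      (measurable_Cfun hn s ω lam u).aestronglyMeasurable]
  have hveq : ∫ p, v p.2 ∂Γ = (1 / n : ℝ) * ∑ i, v (ω i) := by
    rw [← integral_map measurable_snd.aemeasurable hvm.aestronglyMeasurable, hsnd,
      integral_smul_measure, integral_finsetSum_measure]
    · simp
    · exact fun i _ => Integrable.of_bound hvm.aestronglyMeasurable K
        (Filter.Eventually.of_forall hvb)
  have hmean : (1 / n : ℝ) * ∑ i, u i ≤ ∫ p, v p.2 ∂Γ := by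
    rw [hveq]
    exact mul_le_mul_of_nonneg_left (Finset.sum_le_sum fun i _ => hvω i) (by positivity)
  calc ∫ x, Cfun hn s ω lam u x ∂P = ∫ p, Cfun hn s ω lam u p.1 ∂Γ := hCeq
    _ ≤ ∫ p, (lam * dist p.1 p.2 ^ s - v p.2) ∂Γ := by
      refine integral_mono_ae hCΓ ((hd.const_mul lam).sub hvΓ) ?_
      filter_upwards [hae] with p ⟨j, hj⟩
      simpa [hj] using hle p.1 j
    _ = lam * ∫ p, dist p.1 p.2 ^ s ∂Γ - ∫ p, v p.2 ∂Γ := by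
      rw [integral_sub (hd.const_mul lam) hvΓ, integral_const_mul]
    _ ≤ _ := by linarith

/-- Couplings whose cost is arbitrarily close to the Wasserstein radius. -/
lemma exists_coupling_of_wassE_le [PseudoMetricSpace 𝒳] [SecondCountableTopology 𝒳]
    [MeasurableSpace 𝒳] [BorelSpace 𝒳] {s : ℝ} (hs : 0 < s) {P P' : Measure 𝒳} {r : ℝ}
    (hr : 0 ≤ r) (h : wassE s P P' ≤ ENNReal.ofReal r) {ε : ℝ} (hε : 0 < ε) :
    ∃ Γ : Measure (𝒳 × 𝒳), IsProbabilityMeasure Γ ∧ Γ.map Prod.fst = P ∧ Γ.map Prod.snd = P' ∧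
      Integrable (fun p : 𝒳 × 𝒳 => dist p.1 p.2 ^ s) Γ ∧
      ∫ p, dist p.1 p.2 ^ s ∂Γ ≤ r ^ s + ε := by
  rw [wassE, one_div, ENNReal.rpow_inv_le_iff hs, ENNReal.ofReal_rpow_of_nonneg hr hs.le] at h
  have hlt : ENNReal.ofReal (r ^ s) < ENNReal.ofReal (r ^ s + ε) :=
    (ENNReal.ofReal_lt_ofReal_iff (by positivity)).2 (by linarith)
  obtain ⟨Γ, hΓ⟩ := iInf_lt_iff.1 (h.trans_lt hlt)
  obtain ⟨⟨hprob, hfst, hsnd⟩, hcost⟩ := iInf_lt_iff.1 hΓ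
  have hnn (p : 𝒳 × 𝒳) : 0 ≤ dist p.1 p.2 ^ s := by positivity
  have hint : Integrable (fun p : 𝒳 × 𝒳 => dist p.1 p.2 ^ s) Γ :=
    integrable_of_lintegral_ofReal_lt_top (measurable_dist.pow_const s).aestronglyMeasurable hnn
      (hcost.trans ENNReal.ofReal_lt_top)
  refine ⟨Γ, hprob, hfst, hsnd, hint, ?_⟩
  rw [← ENNReal.ofReal_le_ofReal_iff (by positivity),
    ofReal_integral_eq_lintegral_ofReal hint (Filter.Eventually.of_forall hnn)]
  exact hcost.le

end WeakDuality

/-- **weak duality.** For every probability measure `P` with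
`W_s(P, P̂_n) ≤ r` and finite `s`-th moment, and every `λ ≥ 0`, `u ∈ ℝ^n` with
`0 < η(λ,u) < ∞`, one has `KL(P‖Q) ≥ -λ r^s + (1/n) Σ u_i - log η(λ,u)`. -/
theorem stmt4 {𝒳 : Type*} [MetricSpace 𝒳] [PolishSpace 𝒳] [MeasurableSpace 𝒳] [BorelSpace 𝒳]
    (s : ℝ) (hs : 1 ≤ s) (n : ℕ) (hn : 1 ≤ n) (ω : Fin n → 𝒳)
    (μ : Measure 𝒳) [SigmaFinite μ] (q : 𝒳 → ℝ) (hq : Measurable q) (hq0 : ∀ x, 0 ≤ q x)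
    (Q : Measure 𝒳) [IsProbabilityMeasure Q]
    (hQ : Q = μ.withDensity fun x => ENNReal.ofReal (q x))
    (r : ℝ) (hr : 0 ≤ r)
    (P : Measure 𝒳) [IsProbabilityMeasure P]
    (hball : wassE s P ((n : ℝ≥0∞)⁻¹ • ∑ i, Measure.dirac (ω i)) ≤ ENNReal.ofReal r)
    (hmom : ∫⁻ x, ENNReal.ofReal (dist x (ω ⟨0, hn⟩) ^ s) ∂P < ∞)
    (lam : ℝ) (hlam : 0 ≤ lam) (u : Fin n → ℝ)
    (hη : 0 < etaFun hn s ω μ q lam u ∧ etaFun hn s ω μ q lam u < ∞) :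
    ENNReal.ofReal (-lam * r ^ s + (1 / n : ℝ) * ∑ i, u i -
        Real.log (etaFun hn s ω μ q lam u).toReal) ≤ klDiv P Q := by
  have hs0 : 0 < s := by linarith
  rw [klDiv]
  split_ifs with hkl
  swap
  · exact le_top
  obtain ⟨hPQ, hllr⟩ := hkl
  have hC := integrable_Cfun hn s ω hlam u hmom
  have hCm := measurable_Cfun hn s ω lam u
  have hexpm : Measurable fun x => Real.exp (-Cfun hn s ω lam u x) :=
    Real.measurable_exp.comp hCm.neg
  have hηQ : etaFun hn s ω μ q lam u =
      ∫⁻ x, ENNReal.ofReal (Real.exp (-Cfun hn s ω lam u x)) ∂Q := by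
    rw [hQ, lintegral_withDensity_eq_lintegral_mul _ hq.ennreal_ofReal hexpm.ennreal_ofReal]
    simp only [etaFun, Pi.mul_apply, ENNReal.ofReal_mul (hq0 _)]
  have hexp : Integrable (fun x => Real.exp (-Cfun hn s ω lam u x)) Q :=
    integrable_of_lintegral_ofReal_lt_top hexpm.aestronglyMeasurable
      (fun x => (Real.exp_pos _).le) (hηQ ▸ hη.2)
  have hηint : (etaFun hn s ω μ q lam u).toReal =
      ∫ x, Real.exp (-Cfun hn s ω lam u x) ∂Q := by
    rw [hηQ, integral_eq_lintegral_of_nonneg_ae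
      (Filter.Eventually.of_forall fun x => (Real.exp_pos _).le) hexpm.aestronglyMeasurable]
  have hdv := integral_sub_log_integral_exp_le_integral_llr hPQ hllr hC.neg hexp
  simp only [Pi.neg_apply, integral_neg] at hdv
  have hCle : ∫ x, Cfun hn s ω lam u x ∂P ≤ lam * r ^ s - (1 / n : ℝ) * ∑ i, u i := by
    refine le_of_forall_pos_le_add fun ε hε => ?_
    obtain ⟨Γ, hΓ, hfst, hsnd, hint, hcost⟩ :=
      exists_coupling_of_wassE_le hs0 hr hball (div_pos hε (by linarith : 0 < lam + 1))
    have h := integral_Cfun_le_of_coupling hn s ω u hC hfst hsnd hint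
    have h1 := mul_le_mul_of_nonneg_left hcost hlam
    have h2 : lam * (ε / (lam + 1)) ≤ ε := by
      rw [mul_div_assoc', div_le_iff₀ (by linarith)]
      nlinarith
    linarith
  refine ENNReal.ofReal_le_ofReal (le_trans ?_ hdv)
  rw [hηint]
  linarith
end

section
/- Let ω ∈ ℝ with ω ≠ 0 and let ρ > 0. Define φ : [0,∞) → ℝ by φ(λ) := −λ ρ + λ ω² / (1 + 2λ) + (1/2) log(1 + 2λ). If ρ ≤ 1 + ω², then φ attains its maximum over [0,∞) at λ* = ω² / (√(1 + 4ρω²) − 1) − 1/2, and this λ* is nonnegative; if ρ ≥ 1 + ω², then φ attains its maximum over [0,∞) at λ* = 0. -/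
/-- A point `L` satisfying the first-order optimality inequality in the direction of `l`
dominates `l` for the function `-l * ρ + l * c / (1 + 2 * l) + (1 / 2) * log (1 + 2 * l)`. -/
theorem dual_objective_le_of_first_order {c ρ l L : ℝ} (hc : 0 ≤ c) (hl : 0 < 1 + 2 * l)
    (hL : 0 < 1 + 2 * L)
    (h : 0 ≤ (ρ - c / (1 + 2 * L) ^ 2 - 1 / (1 + 2 * L)) * (l - L)) :
    -l * ρ + l * c / (1 + 2 * l) + (1 / 2) * Real.log (1 + 2 * l) ≤
      -L * ρ + L * c / (1 + 2 * L) + (1 / 2) * Real.log (1 + 2 * L) := by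
  have hlog : Real.log (1 + 2 * l) - Real.log (1 + 2 * L) ≤ (1 + 2 * l) / (1 + 2 * L) - 1 := by
    rw [← Real.log_div hl.ne' hL.ne']
    exact Real.log_le_sub_one_of_pos (div_pos hl hL)
  have hsq : 0 ≤ 2 * c * (l - L) ^ 2 / ((1 + 2 * l) * (1 + 2 * L) ^ 2) := by positivity
  have key : -L * ρ + L * c / (1 + 2 * L) - (-l * ρ + l * c / (1 + 2 * l))
      - (1 / 2) * ((1 + 2 * l) / (1 + 2 * L) - 1)
      = (ρ - c / (1 + 2 * L) ^ 2 - 1 / (1 + 2 * L)) * (l - L)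
        + 2 * c * (l - L) ^ 2 / ((1 + 2 * l) * (1 + 2 * L) ^ 2) := by
    obtain ⟨t, ht⟩ : ∃ t, t = 1 + 2 * l := ⟨_, rfl⟩
    obtain ⟨T, hT⟩ : ∃ T, T = 1 + 2 * L := ⟨_, rfl⟩
    obtain rfl : l = (t - 1) / 2 := by linarith
    obtain rfl : L = (T - 1) / 2 := by linarith
    rw [← ht] at hl ⊢
    rw [← hT] at hL ⊢
    field_simp
    ring
  linarith

/-- Let `ω ≠ 0`, `ρ > 0`, and
`φ(λ) := -λρ + λω²/(1+2λ) + (1/2) log(1+2λ)` on `[0,∞)`.  If `ρ ≤ 1 + ω²` then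
`λ* := ω²/(√(1+4ρω²) - 1) - 1/2` is nonnegative and `φ` attains its maximum over
`[0,∞)` at `λ*`; if `ρ ≥ 1 + ω²` then `φ` attains its maximum over `[0,∞)` at `0`. -/
theorem stmt15 (ω ρ : ℝ) (hω : ω ≠ 0) (hρ : 0 < ρ) :
    let φ : ℝ → ℝ := fun lam =>
      -lam * ρ + lam * ω ^ 2 / (1 + 2 * lam) + (1 / 2) * Real.log (1 + 2 * lam)
    let lamstar : ℝ := ω ^ 2 / (Real.sqrt (1 + 4 * ρ * ω ^ 2) - 1) - 1 / 2
    (ρ ≤ 1 + ω ^ 2 → 0 ≤ lamstar ∧ IsMaxOn φ (Set.Ici 0) lamstar) ∧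
      (1 + ω ^ 2 ≤ ρ → IsMaxOn φ (Set.Ici 0) 0) := by
  intro φ lamstar
  have hc : 0 < ω ^ 2 := by positivity
  refine ⟨fun hle => ?_, fun hge l (hl : 0 ≤ l) => ?_⟩
  · have hs2 : Real.sqrt (1 + 4 * ρ * ω ^ 2) ^ 2 = 1 + 4 * ρ * ω ^ 2 :=
      Real.sq_sqrt (by positivity)
    have hs1 : 0 < Real.sqrt (1 + 4 * ρ * ω ^ 2) - 1 :=
      sub_pos.2 (Real.lt_sqrt_of_sq_lt (by nlinarith [mul_pos hρ hc]))
    have hs : Real.sqrt (1 + 4 * ρ * ω ^ 2) - 1 ≤ 2 * ω ^ 2 := by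
      have : Real.sqrt (1 + 4 * ρ * ω ^ 2) ≤ 1 + 2 * ω ^ 2 :=
        Real.sqrt_le_iff.2 ⟨by positivity, by nlinarith⟩
      linarith
    have h0 : 0 ≤ lamstar := by
      refine sub_nonneg.2 ((le_div_iff₀ hs1).2 ?_)
      linarith
    refine ⟨h0, fun l (hl : 0 ≤ l) => ?_⟩
    refine dual_objective_le_of_first_order hc.le (by linarith) (by linarith) (le_of_eq ?_)
    have hT : 1 + 2 * lamstar = 2 * ω ^ 2 / (Real.sqrt (1 + 4 * ρ * ω ^ 2) - 1) := by
      simp only [lamstar]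
      ring
    have hcrit : ρ - ω ^ 2 / (1 + 2 * lamstar) ^ 2 - 1 / (1 + 2 * lamstar) = 0 := by
      rw [hT]
      generalize Real.sqrt (1 + 4 * ρ * ω ^ 2) = s at hs1 hs2
      field_simp
      linarith
    rw [hcrit, zero_mul]
  · refine dual_objective_le_of_first_order hc.le (by linarith) (by norm_num)
      (mul_nonneg ?_ (by linarith))
    norm_num
    linarith
end
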